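/- For every integer Q ≥ 1, the unit ball 𝕋 is the disjoint union, over monic r ∈ 𝔽_q[t] with deg r ≤ Q and over a ∈ 𝔽_q[t] with |a| < |r| and gcd(a, r) = 1, of the sets {α ∈ 𝕋 : |r·α − a| < q^{−Q}}; that is, every α ∈ 𝕋 lies in exactly one such set. -/

import Mathlib

open Polynomial MeasureTheory
open scoped Classical

noncomputable section

variable (Fq : Type) [Field Fq] [Fintype Fq]

/-- `K_∞ = 𝔽_q((1/t))`, encoded as formal Laurent series in `X = t⁻¹`;
the coefficient of `t^{-i}` of `α` is `α.coeff i`. -/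
abbrev Kinf := LaurentSeries Fq

/-- The element `t ∈ K_∞` (i.e. `X⁻¹`). -/
def tK : Kinf Fq := HahnSeries.single (-1 : ℤ) 1

/-- The embedding `𝔽_q[t] → K_∞` sending `t` to `tK`. -/
def polyToK : Polynomial Fq →+* Kinf Fq := Polynomial.eval₂RingHom HahnSeries.C (tK Fq)

/-- The absolute value at infinity on `K_∞`: `|α| = q^{deg α}`, `|0| = 0`. -/
def absK (α : Kinf Fq) : ℝ :=
  if α = 0 then 0 else (Fintype.card Fq : ℝ) ^ (-(HahnSeries.order α))

/-- The additive character `e_q(a) = exp(2πi·tr(a)/p)` of `𝔽_q`. -/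
def eFq (a : Fq) : ℂ :=
  letI : Algebra (ZMod (ringChar Fq)) Fq := ZMod.algebra _ _
  Complex.exp (2 * Real.pi * Complex.I *
    (((ZMod.val (Algebra.trace (ZMod (ringChar Fq)) Fq a)) : ℂ) / (ringChar Fq : ℂ)))

/-- The additive character `ψ : K_∞ → ℂ`, `ψ(α) = e_q(a_{-1})`. -/
def psiK (α : Kinf Fq) : ℂ := eFq Fq (α.coeff 1)

/-- The Borel σ-algebra of `K_∞`, generated by the metric balls. -/
def KinfMS : MeasurableSpace (Kinf Fq) :=
  MeasurableSpace.generateFrom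
    {s : Set (Kinf Fq) | ∃ (a : Kinf Fq) (n : ℤ),
      s = {x | absK Fq (x - a) < (Fintype.card Fq : ℝ) ^ n}}

end

theorem exists_monic_isCoprime_mul_eq {K : Type*} [Field K] {f : K[X]} (hf : f ≠ 0) (a : K[X]) :
    ∃ h r b : K[X], r.Monic ∧ IsCoprime b r ∧ f = h * r ∧ a = h * b := by
  let := EuclideanDomain.gcdMonoid K[X]
  obtain ⟨g, f', a', hfa, rfl, rfl⟩ :
      ∃ g f' a' : K[X], IsCoprime a' f' ∧ f = g * f' ∧ a = g * a' :=
    ⟨EuclideanDomain.gcd a f, _, _, isCoprime_div_gcd_div_gcd hf,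
      (EuclideanDomain.mul_div_cancel' (mt (fun h => (EuclideanDomain.gcd_eq_zero_iff.1 h).2) hf)
        (EuclideanDomain.gcd_dvd_right a f)).symm,
      (EuclideanDomain.mul_div_cancel' (mt (fun h => (EuclideanDomain.gcd_eq_zero_iff.1 h).2) hf)
        (EuclideanDomain.gcd_dvd_left a f)).symm⟩
  have hf' : f' ≠ 0 := right_ne_zero_of_mul hf
  have hc : f'.leadingCoeff ≠ 0 := leadingCoeff_ne_zero.2 hf'
  have hCC : (C f'.leadingCoeff : K[X]) * C f'.leadingCoeff⁻¹ = 1 := by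
    rw [← C_mul, mul_inv_cancel₀ hc, C_1]
  have hu : IsUnit (C f'.leadingCoeff⁻¹ : K[X]) := isUnit_C.2 (inv_ne_zero hc).isUnit
  refine ⟨g * C f'.leadingCoeff, f' * C f'.leadingCoeff⁻¹, a' * C f'.leadingCoeff⁻¹,
    monic_mul_leadingCoeff_inv hf', ?_, ?_, ?_⟩
  · rwa [isCoprime_mul_unit_right hu]
  · linear_combination -(g * f') * hCC
  · linear_combination -(g * a') * hCC

theorem eq_and_eq_of_monic_of_isCoprime {K : Type*} [Field K] {r s a b : K[X]} (hr : r.Monic)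
    (hs : s.Monic) (har : IsCoprime a r) (hbs : IsCoprime b s) (h : a * s = b * r) :
    r = s ∧ a = b := by
  have hrs : r = s := eq_of_monic_of_associated hr hs <| associated_of_dvd_dvd
    (har.symm.dvd_of_dvd_mul_left (h ▸ dvd_mul_left r b))
    (hbs.symm.dvd_of_dvd_mul_left (h ▸ dvd_mul_left s a))
  subst hrs
  exact ⟨rfl, mul_right_cancel₀ hr.ne_zero h⟩

section

variable (Fq : Type) [Field Fq]

theorem polyToK_C (c : Fq) : polyToK Fq (C c) = HahnSeries.C c := by
  simp [polyToK]

theorem polyToK_monomial (n : ℕ) (c : Fq) :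
    polyToK Fq (monomial n c) = HahnSeries.single (-(n : ℤ)) c := by
  simp [polyToK, tK, HahnSeries.single_pow, HahnSeries.C_apply, HahnSeries.single_mul_single]

theorem coeff_polyToK_neg (f : Fq[X]) (n : ℕ) :
    (polyToK Fq f).coeff (-(n : ℤ)) = f.coeff n := by
  induction f using Polynomial.induction_on' with
  | add p r hp hr => simp [hp, hr]
  | monomial m c =>
    rw [polyToK_monomial, HahnSeries.coeff_single, coeff_monomial]
    simp [eq_comm]

theorem coeff_polyToK_of_pos (f : Fq[X]) {i : ℤ} (hi : 0 < i) :
    (polyToK Fq f).coeff i = 0 := by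
  induction f using Polynomial.induction_on' with
  | add p r hp hr => simp [hp, hr]
  | monomial m c =>
    rw [polyToK_monomial, HahnSeries.coeff_single_of_ne]
    lia

theorem polyToK_injective : Function.Injective (polyToK Fq) := by
  intro f g h
  ext n
  rw [← coeff_polyToK_neg, ← coeff_polyToK_neg, h]

theorem polyToK_ne_zero {f : Fq[X]} (hf : f ≠ 0) : polyToK Fq f ≠ 0 := by
  rwa [Ne, map_eq_zero_iff _ (polyToK_injective Fq)]

theorem exists_polyToK_coeff_eq (x : Kinf Fq) :
    ∃ a : Fq[X], ∀ i ≤ 0, (polyToK Fq a).coeff i = x.coeff i := by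
  refine ⟨∑ n ∈ Finset.range ((-x.order).toNat + 1), monomial n (x.coeff (-(n : ℤ))), ?_⟩
  intro i hi
  obtain ⟨n, rfl⟩ : ∃ n : ℕ, i = -(n : ℤ) := ⟨i.natAbs, by lia⟩
  rw [coeff_polyToK_neg]
  simp only [finsetSum_coeff, coeff_monomial, Finset.sum_ite_eq', Finset.mem_range]
  split_ifs with h
  · rfl
  · exact (HahnSeries.coeff_eq_zero_of_lt_order (by lia)).symm

theorem exists_polyToK_mul_coeff_eq_zero (Q : ℕ) (α : Kinf Fq) :
    ∃ f : Fq[X], f ≠ 0 ∧ f.natDegree ≤ Q ∧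
      ∀ i : ℤ, 0 < i → i ≤ Q → (polyToK Fq f * α).coeff i = 0 := by
  let L : degreeLT Fq (Q + 1) →ₗ[Fq] (Fin Q → Fq) :=
    { toFun := fun f i => (polyToK Fq f * α).coeff ((i : ℤ) + 1)
      map_add' := fun f g => by
        ext i
        simp [add_mul]
      map_smul' := fun c f => by
        ext i
        simp only [Submodule.coe_smul, smul_eq_C_mul, map_mul, polyToK_C, mul_assoc,
          HahnSeries.C_apply, HahnSeries.coeff_single_zero_mul]
        rfl }
  have hL : LinearMap.ker L ≠ ⊥ := L.ker_ne_bot_of_finrank_lt <| by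
    rw [(degreeLTEquiv Fq (Q + 1)).finrank_eq]
    simp
  obtain ⟨f, hf, hf0⟩ := (Submodule.ne_bot_iff _).1 hL
  have hf0' : (f : Fq[X]) ≠ 0 := by simpa using hf0
  refine ⟨f, hf0', ?_, fun i hi hiQ => ?_⟩
  · have := (natDegree_lt_iff_degree_lt hf0').2 (mem_degreeLT.1 f.2)
    lia
  · have := congrFun (LinearMap.mem_ker.1 hf) ⟨(i - 1).toNat, by lia⟩
    rwa [show i = (((i - 1).toNat : ℕ) : ℤ) + 1 by lia]

variable [Fintype Fq]

theorem one_lt_card_real : (1 : ℝ) < Fintype.card Fq := by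
  exact_mod_cast Fintype.one_lt_card

theorem absK_zero : absK Fq 0 = 0 := by simp [absK]

theorem absK_pos {x : Kinf Fq} (hx : x ≠ 0) : 0 < absK Fq x := by
  have := one_lt_card_real Fq
  rw [absK, if_neg hx]
  positivity

theorem absK_nonneg (x : Kinf Fq) : 0 ≤ absK Fq x := by
  by_cases hx : x = 0
  · simp [hx, absK_zero]
  · exact (absK_pos Fq hx).le

theorem absK_mul (x y : Kinf Fq) : absK Fq (x * y) = absK Fq x * absK Fq y := by
  by_cases hx : x = 0
  · simp [hx, absK_zero]
  by_cases hy : y = 0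
  · simp [hy, absK_zero]
  have := one_lt_card_real Fq
  rw [absK, absK, absK, if_neg hx, if_neg hy, if_neg (mul_ne_zero hx hy),
    HahnSeries.order_mul hx hy, neg_add, zpow_add₀ (by positivity)]

theorem absK_lt_zpow_iff (x : Kinf Fq) (n : ℤ) :
    absK Fq x < (Fintype.card Fq : ℝ) ^ n ↔ ∀ i ≤ -n, x.coeff i = 0 := by
  have hq := one_lt_card_real Fq
  by_cases hx : x = 0
  · subst hx
    rw [absK_zero]
    simp only [HahnSeries.coeff_zero, implies_true, iff_true]
    positivity
  · have h := HahnSeries.le_order_iff_forall (i := -n + 1) hx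
    simp only [Int.lt_add_one_iff] at h
    rw [absK, if_neg hx, zpow_lt_zpow_iff_right₀ hq, ← h]
    lia

theorem absK_sub_lt {x y : Kinf Fq} {n : ℤ} (hx : absK Fq x < (Fintype.card Fq : ℝ) ^ n)
    (hy : absK Fq y < (Fintype.card Fq : ℝ) ^ n) :
    absK Fq (x - y) < (Fintype.card Fq : ℝ) ^ n := by
  rw [absK_lt_zpow_iff] at *
  intro i hi
  rw [HahnSeries.coeff_sub, hx i hi, hy i hi, sub_zero]

theorem absK_polyToK {f : Fq[X]} (hf : f ≠ 0) :
    absK Fq (polyToK Fq f) = (Fintype.card Fq : ℝ) ^ (f.natDegree : ℤ) := by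
  have h0 := polyToK_ne_zero Fq hf
  have horder : (polyToK Fq f).order = -(f.natDegree : ℤ) := by
    refine le_antisymm (HahnSeries.order_le_of_coeff_ne_zero ?_)
      ((HahnSeries.le_order_iff_forall h0).2 fun i hi => ?_)
    · rw [coeff_polyToK_neg]
      exact leadingCoeff_ne_zero.2 hf
    · obtain ⟨n, rfl⟩ : ∃ n : ℕ, i = -(n : ℤ) := ⟨i.natAbs, by lia⟩
      rw [coeff_polyToK_neg]
      exact coeff_eq_zero_of_natDegree_lt (by lia)
  rw [absK, if_neg h0, horder, neg_neg]

theorem one_le_absK_polyToK {f : Fq[X]} (hf : f ≠ 0) : 1 ≤ absK Fq (polyToK Fq f) := by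
  rw [absK_polyToK Fq hf]
  exact one_le_zpow₀ (one_lt_card_real Fq).le (by positivity)

theorem absK_polyToK_le {f : Fq[X]} {n : ℕ} (hf : f.natDegree ≤ n) :
    absK Fq (polyToK Fq f) ≤ (Fintype.card Fq : ℝ) ^ (n : ℤ) := by
  have := one_lt_card_real Fq
  by_cases h0 : f = 0
  · rw [h0, map_zero, absK_zero]
    positivity
  · rw [absK_polyToK Fq h0]
    exact zpow_le_zpow_right₀ this.le (by exact_mod_cast hf)

/-- Dirichlet's approximation theorem for `K_∞`, without the coprimality condition. -/
theorem exists_absK_mul_sub_lt (Q : ℕ) (α : Kinf Fq) :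
    ∃ f a : Fq[X], f ≠ 0 ∧ f.natDegree ≤ Q ∧
      absK Fq (polyToK Fq f * α - polyToK Fq a) < (Fintype.card Fq : ℝ) ^ (-(Q : ℤ)) := by
  obtain ⟨f, hf, hfQ, hfα⟩ := exists_polyToK_mul_coeff_eq_zero Fq Q α
  obtain ⟨a, ha⟩ := exists_polyToK_coeff_eq Fq (polyToK Fq f * α)
  refine ⟨f, a, hf, hfQ, (absK_lt_zpow_iff Fq _ _).2 fun i hi => ?_⟩
  rw [HahnSeries.coeff_sub]
  rcases le_or_gt i 0 with h | h
  · rw [ha i h, sub_self]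
  · rw [hfα i h (by lia), coeff_polyToK_of_pos Fq a h, sub_zero]

theorem absK_polyToK_mul_lt_one {Q : ℕ} {f : Fq[X]} (hf : f.natDegree ≤ Q) {x : Kinf Fq}
    (hx : absK Fq x < (Fintype.card Fq : ℝ) ^ (-(Q : ℤ))) :
    absK Fq (polyToK Fq f * x) < (Fintype.card Fq : ℝ) ^ (0 : ℤ) := by
  have hq := one_lt_card_real Fq
  have hq0 : (0 : ℝ) < (Fintype.card Fq : ℝ) ^ (Q : ℤ) := by positivity
  calc absK Fq (polyToK Fq f * x)
      ≤ (Fintype.card Fq : ℝ) ^ (Q : ℤ) * absK Fq x := by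
        rw [absK_mul]
        exact mul_le_mul_of_nonneg_right (absK_polyToK_le Fq hf) (absK_nonneg Fq x)
    _ < (Fintype.card Fq : ℝ) ^ (Q : ℤ) * (Fintype.card Fq : ℝ) ^ (-(Q : ℤ)) :=
        mul_lt_mul_of_pos_left hx hq0
    _ = (Fintype.card Fq : ℝ) ^ (0 : ℤ) := by
        rw [← zpow_add₀ (by positivity), add_neg_cancel]

theorem absK_polyToK_lt_of_absK_mul_sub_lt_one {r b : Fq[X]} (hr : r ≠ 0) {α : Kinf Fq}
    (hα : absK Fq α < 1) (h : absK Fq (polyToK Fq r * α - polyToK Fq b) < 1) :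
    absK Fq (polyToK Fq b) < absK Fq (polyToK Fq r) := by
  have h1 : absK Fq (polyToK Fq r * α) < absK Fq (polyToK Fq r) := by
    rw [absK_mul]
    exact mul_lt_of_lt_one_right (absK_pos Fq (polyToK_ne_zero Fq hr)) hα
  have h2 := h.trans_le (one_le_absK_polyToK Fq hr)
  rw [absK_polyToK Fq hr] at *
  rw [← sub_sub_cancel (polyToK Fq r * α) (polyToK Fq b)]
  exact absK_sub_lt Fq h1 h2

end

noncomputable section

/-- **Dissection of the circle (Browning–Vishe).** For `Q ≥ 1`, every `α ∈ 𝕋` lies in exactly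
one of the sets `{α : |rα − a| < q^{−Q}}`, for `r` monic of degree `≤ Q` and `|a| < |r|` with
`gcd(a,r) = 1`. -/
theorem stmt_15 (Fq : Type) [Field Fq] [Fintype Fq] (Q : ℕ) (hQ : 1 ≤ Q)
    (α : Kinf Fq) (hα : absK Fq α < 1) :
    ∃! p : Polynomial Fq × Polynomial Fq,
      p.1.Monic ∧ p.1.natDegree ≤ Q ∧
        absK Fq (polyToK Fq p.2) < absK Fq (polyToK Fq p.1) ∧
        IsCoprime p.2 p.1 ∧
        absK Fq (polyToK Fq p.1 * α - polyToK Fq p.2) < (Fintype.card Fq : ℝ) ^ (-(Q : ℤ)) := by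
  have hq := one_lt_card_real Fq
  obtain ⟨f, a, hf, hfQ, hfa⟩ := exists_absK_mul_sub_lt Fq Q α
  obtain ⟨h, r, b, hr, hbr, rfl, rfl⟩ := exists_monic_isCoprime_mul_eq hf a
  have h0 : h ≠ 0 := left_ne_zero_of_mul hf
  have hrQ : r.natDegree ≤ Q := (natDegree_le_of_dvd (dvd_mul_left r h) hf).trans hfQ
  have happrox : absK Fq (polyToK Fq r * α - polyToK Fq b) <
      (Fintype.card Fq : ℝ) ^ (-(Q : ℤ)) := by
    rw [map_mul, map_mul, mul_assoc, ← mul_sub, absK_mul] at hfa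
    exact (le_mul_of_one_le_left (absK_nonneg Fq _) (one_le_absK_polyToK Fq h0)).trans_lt hfa
  have hlt : absK Fq (polyToK Fq b) < absK Fq (polyToK Fq r) :=
    absK_polyToK_lt_of_absK_mul_sub_lt_one Fq hr.ne_zero hα
      (happrox.trans_le (zpow_le_one_of_nonpos₀ hq.le (by lia)))
  refine ⟨(r, b), ⟨hr, hrQ, hlt, hbr, happrox⟩, ?_⟩
  rintro ⟨s, c⟩ ⟨hs, hsQ, -, hcs, hsc⟩
  have hcross : c * r - b * s = 0 := by
    by_contra hne
    have hsmall := absK_sub_lt Fq (absK_polyToK_mul_lt_one Fq hsQ happrox)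
      (absK_polyToK_mul_lt_one Fq hrQ hsc)
    rw [show polyToK Fq s * (polyToK Fq r * α - polyToK Fq b) -
        polyToK Fq r * (polyToK Fq s * α - polyToK Fq c) = polyToK Fq (c * r - b * s) by
      simp only [map_sub, map_mul]; ring, zpow_zero] at hsmall
    exact hsmall.not_ge (one_le_absK_polyToK Fq hne)
  obtain ⟨rfl, rfl⟩ := eq_and_eq_of_monic_of_isCoprime hs hr hcs hbr (sub_eq_zero.1 hcross)
  rfl

end
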